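/- For the acceptance modes (σ,ρ) ∈ {(ran,⊆), (inf,⊆)}, the families of ω-languages accepted by context-free ω-grammars via normal derivations and via leftmost derivations coincide: 𝓛_{σ,ρ,nl}(ω-CFG) = 𝓛_{σ,ρ,l}(ω-CFG). Moreover, for these two modes every individual ω-CFG G satisfies L_{σ,⊆,nl}(G) = L_{σ,⊆,l}(G). -/

import Mathlib

namespace OmegaFormal

/-- σ component of an acceptance mode: `ran` (occurs at least once)
or `inf` (occurs infinitely often). -/
inductive AccSigma | ran | inf
deriving DecidableEq

/-- ρ component of an acceptance mode: `cap` (nonempty intersection, ⊓),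
`sub` (⊆) or `eq` (=). -/
inductive AccRho | cap | sub | eq
deriving DecidableEq

/-- derivation mode: leftmost (`l`) or normal (`nl`). -/
inductive DerivMode | l | nl
deriving DecidableEq

/-- `sigmaSet σ f` is ran(f) resp. inf(f). -/
def sigmaSet {Q : Type _} : AccSigma → (ℕ → Q) → Set Q
  | .ran, f => Set.range f
  | .inf, f => {q | ∀ n : ℕ, ∃ m : ℕ, n ≤ m ∧ f m = q}

/-- the binary relation denoted by ρ. -/
def rhoRel {Q : Type _} : AccRho → Set Q → Set Q → Prop
  | .cap, A, B => (A ∩ B).Nonempty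
  | .sub, A, B => A ⊆ B
  | .eq,  A, B => A = B

/-- f is (σ,ρ)-accepting w.r.t. the set 𝓕 of designated sets. -/
def IsAccepting {Q : Type _} (σ : AccSigma) (ρ : AccRho) (𝓕 : Set (Set Q)) (f : ℕ → Q) : Prop :=
  ∃ F ∈ 𝓕, rhoRel ρ (sigmaSet σ f) F

/-- the finite word `l` coincides with the prefix of the ω-word `u`. -/
def MatchesPrefix {T : Type _} (l : List T) (u : ℕ → T) : Prop :=
  ∀ (k : ℕ) (h : k < l.length), l.get ⟨k, h⟩ = u k

/-- the maximal terminal prefix of a sentential form. -/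
def termPrefix {N T : Type _} : List (N ⊕ T) → List T
  | [] => []
  | (Sum.inl _) :: _ => []
  | (Sum.inr a) :: l => a :: termPrefix l

/-- A phrase structure ω-grammar `G = (N, T, P, S, 𝓕)`:
`N` nonterminals, `T` terminals, `P` named productions `p : lhs p → rhs p`
with `lhs p ∈ N⁺`, `rhs p ∈ (N ∪ T)*`, start symbol, and
production repetition sets `acc ⊆ 2^P`. -/
structure OmegaPSG (T : Type) where
  N : Type
  [fintypeN : Fintype N]
  P : Type
  [fintypeP : Fintype P]
  lhs : P → List N
  lhs_ne : ∀ p : P, lhs p ≠ []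
  rhs : P → List (N ⊕ T)
  start : N
  acc : Set (Set P)

namespace OmegaPSG

variable {T : Type} (G : OmegaPSG T)

/-- one (normal) rewriting step using production p. -/
def Step (p : G.P) (x y : List (G.N ⊕ T)) : Prop :=
  ∃ u v : List (G.N ⊕ T),
    x = u ++ (G.lhs p).map Sum.inl ++ v ∧ y = u ++ G.rhs p ++ v

/-- one leftmost rewriting step: the rewritten occurrence starts at the
leftmost nonterminal, i.e. everything to its left is terminal. -/
def LStep (p : G.P) (x y : List (G.N ⊕ T)) : Prop :=
  ∃ u v : List (G.N ⊕ T), (∀ s ∈ u, ∃ a : T, s = Sum.inr a) ∧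
    x = u ++ (G.lhs p).map Sum.inl ++ v ∧ y = u ++ G.rhs p ++ v

def StepOf : DerivMode → G.P → List (G.N ⊕ T) → List (G.N ⊕ T) → Prop
  | .l => G.LStep
  | .nl => G.Step

/-- `L_{σ,ρ,π}(G)`: ω-words admitting an infinite π-derivation from S whose
growing terminal prefixes spell the word and whose production sequence is
(σ,ρ)-accepting w.r.t. `G.acc`. -/
def Lang (σ : AccSigma) (ρ : AccRho) (π : DerivMode) : Set (ℕ → T) :=
  {u | ∃ (s : ℕ → List (G.N ⊕ T)) (d : ℕ → G.P),
    s 0 = [Sum.inl G.start] ∧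
    (∀ i : ℕ, G.StepOf π (d i) (s i) (s (i + 1))) ∧
    (∀ n : ℕ, ∃ i : ℕ, n ≤ (termPrefix (s i)).length) ∧
    (∀ i : ℕ, MatchesPrefix (termPrefix (s i)) u) ∧
    IsAccepting σ ρ G.acc d}

/-- context-free: every left-hand side is a single nonterminal. -/
def IsCFG : Prop := ∀ p : G.P, (G.lhs p).length = 1

/-- context-sensitive (monotonic): `|β| ≥ |α|` for every production. -/
def IsCSG : Prop := ∀ p : G.P, (G.lhs p).length ≤ (G.rhs p).length

/-- right linear: productions of the form `A → uB` or `A → u`, `u ∈ T*`. -/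
def IsRLG : Prop :=
  ∀ p : G.P, (G.lhs p).length = 1 ∧
    ∃ (w : List T) (B : Option G.N),
      G.rhs p = w.map Sum.inr ++ B.toList.map Sum.inl

/-- `G` is a grammar with `$`-boundary (PSG version): with `$` = `dollar`,
`S` = `S'`, every production has one of the forms
(1) α → β, α,β ∈ N⁺ (N = nonterminals other than `$`, `S`),
(2) S → $α, α ∈ N⁺, (3) $A → a$, (4) A → ε. -/
def HasDollarBoundary (dollar S' : G.N) : Prop :=
  dollar ≠ S' ∧ G.start = S' ∧
  ∀ p : G.P,
    ((dollar ∉ G.lhs p ∧ S' ∉ G.lhs p) ∧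
      ∃ β : List G.N, β ≠ [] ∧ dollar ∉ β ∧ S' ∉ β ∧ G.rhs p = β.map Sum.inl) ∨
    (G.lhs p = [S'] ∧ ∃ α : List G.N, α ≠ [] ∧ dollar ∉ α ∧ S' ∉ α ∧
      G.rhs p = Sum.inl dollar :: α.map Sum.inl) ∨
    (∃ A : G.N, A ≠ dollar ∧ A ≠ S' ∧ G.lhs p = [dollar, A] ∧
      ∃ a : T, G.rhs p = [Sum.inr a, Sum.inl dollar]) ∨
    (∃ A : G.N, A ≠ dollar ∧ A ≠ S' ∧ G.lhs p = [A] ∧ G.rhs p = [])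

/-- `G` is a grammar with `$`-boundary (CSG version): forms (1)-(3) only,
with `|α| ≤ |β|` in form (1). -/
def HasDollarBoundaryCSG (dollar S' : G.N) : Prop :=
  dollar ≠ S' ∧ G.start = S' ∧
  ∀ p : G.P,
    ((dollar ∉ G.lhs p ∧ S' ∉ G.lhs p) ∧
      ∃ β : List G.N, β ≠ [] ∧ dollar ∉ β ∧ S' ∉ β ∧ (G.lhs p).length ≤ β.length ∧
        G.rhs p = β.map Sum.inl) ∨
    (G.lhs p = [S'] ∧ ∃ α : List G.N, α ≠ [] ∧ dollar ∉ α ∧ S' ∉ α ∧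
      G.rhs p = Sum.inl dollar :: α.map Sum.inl) ∨
    (∃ A : G.N, A ≠ dollar ∧ A ≠ S' ∧ G.lhs p = [dollar, A] ∧
      ∃ a : T, G.rhs p = [Sum.inr a, Sum.inl dollar])

end OmegaPSG

/-- `𝓛_{σ,ρ,π}(X)` for the family `X` of ω-grammars over `T` satisfying `C`. -/
def GLang (T : Type) (C : OmegaPSG T → Prop) (σ : AccSigma) (ρ : AccRho) (π : DerivMode) :
    Set (Set (ℕ → T)) :=
  {L | ∃ G : OmegaPSG T, C G ∧ L = G.Lang σ ρ π}

/-- number of non-ε labels among `b 0, …, b (i-1)`. -/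
def someCount {A : Type _} (b : ℕ → Option A) (i : ℕ) : ℕ :=
  ((Finset.range i).filter fun j => (b j).isSome = true).card

/-- the (ε-allowing) label sequence `b` concatenates to the ω-word `u`. -/
def Spells {A : Type _} (b : ℕ → Option A) (u : ℕ → A) : Prop :=
  (∀ n : ℕ, ∃ i : ℕ, n ≤ someCount b i) ∧
  ∀ i : ℕ, ∀ a : A, b i = some a → a = u (someCount b i)

/-- A finite state ω-automaton `(Q, Σ, δ, q₀, 𝓕)`. -/
structure OmegaFSA (Sig : Type) where
  Q : Type
  [fintypeQ : Fintype Q]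
  init : Q
  trans : Q → Option Sig → Q → Prop
  acc : Set (Set Q)

/-- `L_{σ,ρ}(A)` for a finite state ω-automaton. -/
def OmegaFSA.Lang {Sig : Type} (A : OmegaFSA Sig) (σ : AccSigma) (ρ : AccRho) :
    Set (ℕ → Sig) :=
  {u | ∃ (r : ℕ → A.Q) (b : ℕ → Option Sig),
    r 0 = A.init ∧ (∀ i : ℕ, A.trans (r i) (b i) (r (i + 1))) ∧
    Spells b u ∧ IsAccepting σ ρ A.acc r}

/-- `𝓛_{σ,ρ}(ω-FSA)`. -/
def FSALang (Sig : Type) (σ : AccSigma) (ρ : AccRho) : Set (Set (ℕ → Sig)) :=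
  {L | ∃ A : OmegaFSA Sig, L = A.Lang σ ρ}

/-- A pushdown ω-automaton `(Q, Σ, Γ, δ, q₀, Z₀, 𝓕)`. -/
structure OmegaPDA (Sig : Type) where
  Q : Type
  [fintypeQ : Fintype Q]
  Γ : Type
  [fintypeΓ : Fintype Γ]
  init : Q
  Z0 : Γ
  trans : Q → Option Sig → Γ → Q → List Γ → Prop
  acc : Set (Set Q)

/-- `L_{σ,ρ}(D)` for a pushdown ω-automaton. -/
def OmegaPDA.Lang {Sig : Type} (D : OmegaPDA Sig) (σ : AccSigma) (ρ : AccRho) :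
    Set (ℕ → Sig) :=
  {u | ∃ (q : ℕ → D.Q) (st : ℕ → List D.Γ) (b : ℕ → Option Sig),
    q 0 = D.init ∧ st 0 = [D.Z0] ∧
    (∀ i : ℕ, ∃ (Z : D.Γ) (γ rest : List D.Γ),
      st i = Z :: rest ∧ D.trans (q i) (b i) Z (q (i + 1)) γ ∧ st (i + 1) = γ ++ rest) ∧
    Spells b u ∧ IsAccepting σ ρ D.acc q}

/-- `𝓛_{σ,ρ}(ω-PDA)`. -/
def PDALang (Sig : Type) (σ : AccSigma) (ρ : AccRho) : Set (Set (ℕ → Sig)) :=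
  {L | ∃ D : OmegaPDA Sig, L = D.Lang σ ρ}

/-- tape head moves. -/
inductive Move | L | R | S
deriving DecidableEq

def moveHead : Move → ℕ → ℕ
  | .L, n => n - 1
  | .R, n => n + 1
  | .S, n => n

/-- A single-tape Turing ω-machine `(Q, Σ, Γ, δ, q₀, 𝓕)` (Σ ⊆ Γ via `embed`). -/
structure OmegaTM (Sig : Type) where
  Q : Type
  [fintypeQ : Fintype Q]
  Γ : Type
  [fintypeΓ : Fintype Γ]
  embed : Sig → Γ
  embed_inj : Function.Injective embed
  init : Q
  trans : Q → Γ → Q → Γ → Move → Prop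
  acc : Set (Set Q)

/-- `L_{σ,ρ}(M)`: ω-words admitting a complete non-oscillating run whose state
sequence is (σ,ρ)-accepting. -/
def OmegaTM.Lang {Sig : Type} (M : OmegaTM Sig) (σ : AccSigma) (ρ : AccRho) :
    Set (ℕ → Sig) :=
  {u | ∃ (q : ℕ → M.Q) (tape : ℕ → ℕ → M.Γ) (pos : ℕ → ℕ),
    q 0 = M.init ∧ (∀ n : ℕ, tape 0 n = M.embed (u n)) ∧ pos 0 = 0 ∧
    (∀ i : ℕ, ∃ (g : M.Γ) (m : Move),
      M.trans (q i) (tape i (pos i)) (q (i + 1)) g m ∧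
      tape (i + 1) = Function.update (tape i) (pos i) g ∧
      pos (i + 1) = moveHead m (pos i)) ∧
    (∀ n : ℕ, ∃ i : ℕ, n ≤ pos i) ∧
    (∀ n : ℕ, ∃ i0 : ℕ, ∀ i : ℕ, i0 ≤ i → pos i ≠ n) ∧
    IsAccepting σ ρ M.acc q}

/-- `𝓛_{σ,ρ}(ω-TM)`. -/
def TMLang (Sig : Type) (σ : AccSigma) (ρ : AccRho) : Set (Set (ℕ → Sig)) :=
  {L | ∃ M : OmegaTM Sig, L = M.Lang σ ρ}

/-- An m-tape Turing ω-machine. -/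
structure OmegaMTM (m : ℕ) (Sig : Type) where
  Q : Type
  [fintypeQ : Fintype Q]
  Γ : Type
  [fintypeΓ : Fintype Γ]
  embed : Sig → Γ
  embed_inj : Function.Injective embed
  blank : Γ
  init : Q
  trans : Q → (Fin m → Γ) → Q → (Fin m → Γ) → (Fin m → Move) → Prop
  acc : Set (Set Q)

/-- `L_{σ,ρ}(M)` for an m-tape Turing ω-machine (`hm : 0 < m`; the input is on
the first tape, the other tapes are initially blank; the run must be complete
and non-oscillating on the first tape). -/
def OmegaMTM.Lang {m : ℕ} {Sig : Type} (M : OmegaMTM m Sig) (hm : 0 < m)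
    (σ : AccSigma) (ρ : AccRho) : Set (ℕ → Sig) :=
  {u | ∃ (q : ℕ → M.Q) (tape : ℕ → Fin m → ℕ → M.Γ) (pos : ℕ → Fin m → ℕ),
    q 0 = M.init ∧
    (∀ n : ℕ, tape 0 ⟨0, hm⟩ n = M.embed (u n)) ∧
    (∀ j : Fin m, j ≠ ⟨0, hm⟩ → ∀ n : ℕ, tape 0 j n = M.blank) ∧
    (∀ j : Fin m, pos 0 j = 0) ∧
    (∀ i : ℕ, ∃ (g : Fin m → M.Γ) (mv : Fin m → Move),
      M.trans (q i) (fun j => tape i j (pos i j)) (q (i + 1)) g mv ∧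
      (∀ j : Fin m, tape (i + 1) j = Function.update (tape i j) (pos i j) (g j)) ∧
      (∀ j : Fin m, pos (i + 1) j = moveHead (mv j) (pos i j))) ∧
    (∀ n : ℕ, ∃ i : ℕ, n ≤ pos i ⟨0, hm⟩) ∧
    (∀ n : ℕ, ∃ i0 : ℕ, ∀ i : ℕ, i0 ≤ i → pos i ⟨0, hm⟩ ≠ n) ∧
    IsAccepting σ ρ M.acc q}

/-- `𝓛_{σ,ρ}(m-ω-TM)`. -/
def MTMLang (Sig : Type) (m : ℕ) (hm : 0 < m) (σ : AccSigma) (ρ : AccRho) :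
    Set (Set (ℕ → Sig)) :=
  {L | ∃ M : OmegaMTM m Sig, L = M.Lang hm σ ρ}

/-- the ω-language `{aⁿbⁿ | n ≥ 1}^ω` over the alphabet `Bool`
(`false` = a, `true` = b). -/
def abLang : Set (ℕ → Bool) :=
  {u | ∃ n : ℕ → ℕ, (∀ i : ℕ, 1 ≤ n i) ∧
    ∀ i k : ℕ, k < 2 * n i →
      u ((∑ j ∈ Finset.range i, 2 * n j) + k) = decide (n i ≤ k)}

end OmegaFormal
namespace OmegaFormal

/-- A sentential form is terminal or has a leftmost nonterminal. -/
theorem terminal_or_exists_leftmost {N T : Type*} (x : List (N ⊕ T)) :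
    (∀ s ∈ x, ∃ a : T, s = Sum.inr a) ∨
      ∃ (u : List (N ⊕ T)) (A : N) (v : List (N ⊕ T)),
        (∀ s ∈ u, ∃ a : T, s = Sum.inr a) ∧ x = u ++ Sum.inl A :: v := by
  induction x with
  | nil => simp
  | cons c x ih =>
    rcases c with A | a
    · exact Or.inr ⟨[], A, x, by simp⟩
    · rcases ih with h | ⟨u, A, v, hu, rfl⟩
      · left
        simpa using h
      · exact Or.inr ⟨Sum.inr a :: u, A, v, by simpa using hu, rfl⟩

/-- The decomposition of a sentential form at its leftmost nonterminal is unique. -/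
theorem leftmost_unique {N T : Type*} {u u' v v' : List (N ⊕ T)} {A B : N}
    (hu : ∀ s ∈ u, ∃ a : T, s = Sum.inr a) (hu' : ∀ s ∈ u', ∃ a : T, s = Sum.inr a)
    (h : u ++ Sum.inl A :: v = u' ++ Sum.inl B :: v') : u = u' ∧ A = B ∧ v = v' := by
  induction u generalizing u' with
  | nil =>
    cases u' with
    | nil => simpa using h
    | cons c u' =>
      obtain ⟨a, rfl⟩ := hu' c (by simp)
      simp at h
  | cons c u ih =>
    obtain ⟨a, rfl⟩ := hu c (by simp)
    cases u' with
    | nil => simp at h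
    | cons c' u' =>
      simp only [List.cons_append, List.cons.injEq] at h
      obtain ⟨rfl, h⟩ := h
      obtain ⟨rfl, hAB⟩ := ih (fun s hs => hu s (by simp [hs])) (fun s hs => hu' s (by simp [hs])) h
      exact ⟨rfl, hAB⟩

theorem termPrefix_append_inl_prefix {N T : Type*} (u v w : List (N ⊕ T)) (A : N) :
    termPrefix (u ++ Sum.inl A :: v) <+: termPrefix (u ++ w) := by
  induction u with
  | nil => simp [termPrefix]
  | cons c u ih => rcases c with B | a <;> simp [termPrefix, ih]

theorem termPrefix_append_inl {N T : Type*} (u v w : List (N ⊕ T)) (A : N) :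
    termPrefix (u ++ Sum.inl A :: v) = termPrefix (u ++ Sum.inl A :: w) := by
  induction u with
  | nil => simp [termPrefix]
  | cons c u ih => rcases c with B | a <;> simp [termPrefix, ih]

theorem MatchesPrefix.of_prefix {T : Type*} {l l' : List T} {u : ℕ → T}
    (h : MatchesPrefix l' u) (hl : l <+: l') : MatchesPrefix l u := by
  obtain ⟨r, rfl⟩ := hl
  intro k hk
  rw [← h k (by simp; omega)]
  simp [List.getElem_append_left hk]

/-- The increasing enumeration of `ℕ \ {k}`. -/
def skip (k j : ℕ) : ℕ := if j < k then j else j + 1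

theorem skip_injective (k : ℕ) : Function.Injective (skip k) := by
  intro i j h
  unfold skip at h
  split_ifs at h <;> omega

theorem skip_ne (k j : ℕ) : skip k j ≠ k := by
  unfold skip
  split_ifs <;> omega

theorem skip_succ_succ (k j : ℕ) : skip (k + 1) (j + 1) = skip k j + 1 := by
  unfold skip
  split_ifs <;> omega

theorem sigmaSet_comp_subset {Q : Type*} (σ : AccSigma) (d : ℕ → Q) {f : ℕ → ℕ}
    (hf : Function.Injective f) : sigmaSet σ (d ∘ f) ⊆ sigmaSet σ d := by
  cases σ with
  | ran => exact Set.range_comp_subset_range f d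
  | inf =>
    intro q hq n
    have hinf : {m | d (f m) = q}.Infinite :=
      Set.infinite_of_forall_exists_gt fun a => by
        obtain ⟨m, hm, hmq⟩ := hq (a + 1)
        exact ⟨m, hmq, hm⟩
    obtain ⟨_, ⟨m, hm, rfl⟩, hlt⟩ := (hinf.image hf.injOn).exists_gt n
    exact ⟨f m, hlt.le, hm⟩

namespace OmegaPSG

variable {T : Type} {G : OmegaPSG T}

theorem LStep.step {p : G.P} {x y : List (G.N ⊕ T)} (h : G.LStep p x y) : G.Step p x y := by
  obtain ⟨u, v, -, hx, hy⟩ := h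
  exact ⟨u, v, hx, hy⟩

theorem Step.termPrefix_prefix {p : G.P} {x y : List (G.N ⊕ T)} (h : G.Step p x y) :
    termPrefix x <+: termPrefix y := by
  obtain ⟨u, v, rfl, rfl⟩ := h
  obtain ⟨A, l, hl⟩ := List.exists_cons_of_ne_nil (G.lhs_ne p)
  rw [hl, List.append_assoc, List.append_assoc]
  exact termPrefix_append_inl_prefix ..

/-- A step is leftmost, or it happens to the right of the leftmost nonterminal. -/
theorem Step.lStep_or_right {p : G.P} {x y : List (G.N ⊕ T)} (h : G.Step p x y) :
    G.LStep p x y ∨ ∃ (u : List (G.N ⊕ T)) (A : G.N) (v v' : List (G.N ⊕ T)),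
      (∀ s ∈ u, ∃ a : T, s = Sum.inr a) ∧ x = u ++ Sum.inl A :: v ∧
        y = u ++ Sum.inl A :: v' ∧ G.Step p v v' := by
  obtain ⟨a, b, rfl, rfl⟩ := h
  rcases terminal_or_exists_leftmost a with ha | ⟨u, A, v, hu, rfl⟩
  · exact Or.inl ⟨a, b, ha, rfl, rfl⟩
  · exact Or.inr ⟨u, A, v ++ (G.lhs p).map Sum.inl ++ b, v ++ G.rhs p ++ b, hu,
      by simp, by simp, v, b, rfl, rfl⟩

/-- `s` is an infinite normal derivation with production sequence `d`. -/
def IsDerivation (G : OmegaPSG T) (s : ℕ → List (G.N ⊕ T)) (d : ℕ → G.P) : Prop :=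
  ∀ i, G.Step (d i) (s i) (s (i + 1))

theorem IsDerivation.termPrefix_prefix {s : ℕ → List (G.N ⊕ T)} {d : ℕ → G.P}
    (h : G.IsDerivation s d) {i j : ℕ} (hij : i ≤ j) :
    termPrefix (s i) <+: termPrefix (s j) := by
  induction j, hij using Nat.le_induction with
  | base => exact List.prefix_rfl
  | succ j _ ih => exact ih.trans (h j).termPrefix_prefix

/-- If the terminal prefix of a context-free derivation grows, the step rewriting the leftmost
nonterminal of the first sentential form can be moved to the front. -/
theorem IsDerivation.exists_leftmost_first (hG : G.IsCFG) (n : ℕ)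
    {s : ℕ → List (G.N ⊕ T)} {d : ℕ → G.P} (h : G.IsDerivation s d)
    (hn : (termPrefix (s 0)).length < (termPrefix (s n)).length) :
    ∃ (k : ℕ) (s' : ℕ → List (G.N ⊕ T)), G.LStep (d k) (s 0) (s' 0) ∧
      G.IsDerivation s' (d ∘ skip k) ∧ (∀ j, k ≤ j → s' j = s (j + 1)) ∧
      ∀ t ≤ k, termPrefix (s t) = termPrefix (s 0) := by
  induction n generalizing s d with
  | zero => simp at hn
  | succ n ih =>
    rcases (h 0).lStep_or_right with h0 | ⟨u, A, v, v', hu, hs0, hs1, hv⟩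
    · refine ⟨0, fun j => s (j + 1), h0, fun j => ?_, fun _ _ => rfl, ?_⟩
      · simpa [skip] using h (j + 1)
      · intro t ht
        rw [Nat.le_zero.mp ht]
    · have htp : termPrefix (s 1) = termPrefix (s 0) := by
        rw [hs0, show s 1 = _ from hs1]
        exact termPrefix_append_inl ..
      obtain ⟨k, s', ⟨a, b, ha, hab, hs'⟩, hder, htail, hconst⟩ :=
        ih (s := fun j => s (j + 1)) (d := fun j => d (j + 1)) (fun j => h (j + 1))
          (by simpa [htp] using hn)
      obtain ⟨B, hB⟩ := List.length_eq_one_iff.mp (hG (d (k + 1)))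
      have heq : u ++ Sum.inl A :: v' = a ++ Sum.inl B :: b := by
        rw [← show s 1 = _ from hs1, show s 1 = _ from hab, hB]
        simp
      obtain ⟨rfl, rfl, rfl⟩ := leftmost_unique hu ha heq
      refine ⟨k + 1, fun j => Nat.casesOn j (u ++ G.rhs (d (k + 1)) ++ v) s', ?_, ?_, ?_, ?_⟩
      · exact ⟨u, v, hu, by rw [hs0, hB]; simp, rfl⟩
      · rintro (_ | j)
        · obtain ⟨c, e, rfl, rfl⟩ := hv
          refine ⟨u ++ G.rhs (d (k + 1)) ++ c, e, by simp [skip], ?_⟩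
          simp [hs', skip]
        · simpa [skip_succ_succ] using hder j
      · rintro (_ | j) hj
        · omega
        · exact htail j (by omega)
      · rintro (_ | t) ht
        · rfl
        · exact (hconst t (by omega)).trans htp

/-- A context-free derivation with unbounded terminal prefixes can be turned into a leftmost one
that applies some of its steps, each at most once, and generates the same ω-word. -/
theorem IsDerivation.exists_leftmost (hG : G.IsCFG) {s : ℕ → List (G.N ⊕ T)} {d : ℕ → G.P}
    {w : ℕ → T} (h : G.IsDerivation s d) (hunb : ∀ n, ∃ i, n ≤ (termPrefix (s i)).length)
    (hw : ∀ i, MatchesPrefix (termPrefix (s i)) w) :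
    ∃ (x : ℕ → List (G.N ⊕ T)) (f : ℕ → ℕ), Function.Injective f ∧ x 0 = s 0 ∧
      (∀ i, G.LStep (d (f i)) (x i) (x (i + 1))) ∧
      (∀ n, ∃ i, n ≤ (termPrefix (x i)).length) ∧
      ∀ i, MatchesPrefix (termPrefix (x i)) w := by
  let State := {q : (ℕ → List (G.N ⊕ T)) × (ℕ → ℕ) //
    G.IsDerivation q.1 (d ∘ q.2) ∧ (∀ n, ∃ i, n ≤ (termPrefix (q.1 i)).length) ∧
      (∀ i, MatchesPrefix (termPrefix (q.1 i)) w) ∧ Function.Injective q.2}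
  have hnext : ∀ q : State, ∃ (k : ℕ) (q' : State),
      G.LStep (d (q.1.2 k)) (q.1.1 0) (q'.1.1 0) ∧ q'.1.2 = q.1.2 ∘ skip k ∧
      (∀ j, k ≤ j → q'.1.1 j = q.1.1 (j + 1)) ∧
      ∀ t ≤ k, termPrefix (q.1.1 t) = termPrefix (q.1.1 0) := by
    rintro ⟨⟨s, g⟩, hder, hunb, hw, hg⟩
    dsimp only at hder hunb hw hg ⊢
    obtain ⟨n, hn⟩ := hunb ((termPrefix (s 0)).length + 1)
    obtain ⟨k, s', hstep, hder', htail, hconst⟩ := hder.exists_leftmost_first hG n hn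
    have hpre : ∀ i, termPrefix (s' i) <+: termPrefix (s (i + k + 1)) := fun i => by
      rw [← htail (i + k) (by omega)]
      exact hder'.termPrefix_prefix (by omega)
    refine ⟨k, ⟨(s', g ∘ skip k), hder', fun n => ?_, fun i => (hw _).of_prefix (hpre i),
      hg.comp (skip_injective k)⟩, hstep, rfl, htail, hconst⟩
    obtain ⟨i, hi⟩ := hunb n
    refine ⟨i + k, hi.trans ?_⟩
    simp only [htail (i + k) (by omega)]
    exact (hder.termPrefix_prefix (by omega)).length_le
  choose k next hstep hidx htail hconst using hnext
  let q : ℕ → State := fun m =>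
    next^[m] ⟨(s, id), h, hunb, hw, Function.injective_id⟩
  have hq : ∀ m, q (m + 1) = next (q m) := fun m => Function.iterate_succ_apply' ..
  have hrange : ∀ m m', m ≤ m' → Set.range (q m').1.2 ⊆ Set.range (q m).1.2 := by
    intro m m' hm
    induction m', hm using Nat.le_induction with
    | base => exact subset_rfl
    | succ m' _ ih =>
      rw [hq, hidx]
      exact (Set.range_comp_subset_range _ _).trans ih
  refine ⟨fun m => (q m).1.1 0, fun m => (q m).1.2 (k (q m)), ?_, rfl, fun m => ?_, fun n => ?_,
    fun m => (q m).2.2.2.1 0⟩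
  · refine Function.Injective.of_lt_imp_ne fun m m' hm heq => ?_
    obtain ⟨j, hj⟩ := hrange (m + 1) m' hm ⟨k (q m'), rfl⟩
    rw [hq, hidx, ← heq] at hj
    exact skip_ne _ _ ((q m).2.2.2.2 hj)
  · simp only [hq]
    exact hstep (q m)
  · have hgrow : ∀ t m, ∃ m', (termPrefix ((q m).1.1 t)).length ≤
        (termPrefix ((q m').1.1 0)).length := by
      intro t
      induction t with
      | zero => exact fun m => ⟨m, le_rfl⟩
      | succ t ih =>
        intro m
        by_cases ht : t + 1 ≤ k (q m)
        · exact ⟨m, (congrArg List.length (hconst (q m) _ ht)).le⟩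
        · rw [← htail (q m) t (by omega), ← hq]
          exact ih (m + 1)
    obtain ⟨i, hi⟩ := hunb n
    obtain ⟨m, hm⟩ := hgrow i 0
    exact ⟨m, hi.trans hm⟩

theorem IsCFG.lang_sub_nl_eq_l (hG : G.IsCFG) (σ : AccSigma) :
    G.Lang σ AccRho.sub DerivMode.nl = G.Lang σ AccRho.sub DerivMode.l := by
  ext w
  constructor
  · rintro ⟨s, d, hs, hstep, hunb, hw, F, hF, hacc⟩
    obtain ⟨x, f, hf, hx, hx', hunb', hw'⟩ :=
      IsDerivation.exists_leftmost hG (s := s) (d := d) hstep hunb hw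
    exact ⟨x, d ∘ f, hx.trans hs, hx', hunb', hw', F, hF,
      (sigmaSet_comp_subset σ d hf).trans hacc⟩
  · rintro ⟨s, d, hs, hstep, hrest⟩
    exact ⟨s, d, hs, fun i => LStep.step (hstep i), hrest⟩

end OmegaPSG

end OmegaFormal

open OmegaFormal

/-- Theorem: for (σ,ρ) ∈ {(ran,⊆), (inf,⊆)},
𝓛_{σ,⊆,nl}(ω-CFG) = 𝓛_{σ,⊆,l}(ω-CFG); moreover every individual ω-CFG G
satisfies L_{σ,⊆,nl}(G) = L_{σ,⊆,l}(G). -/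
theorem cfg_nl_eq_l_subAcc (T : Type) [Fintype T] (σ : AccSigma) :
    GLang T OmegaPSG.IsCFG σ AccRho.sub DerivMode.nl
      = GLang T OmegaPSG.IsCFG σ AccRho.sub DerivMode.l ∧
    ∀ G : OmegaPSG T, G.IsCFG →
      G.Lang σ AccRho.sub DerivMode.nl = G.Lang σ AccRho.sub DerivMode.l := by
  refine ⟨?_, fun G hG => hG.lang_sub_nl_eq_l σ⟩
  ext L
  constructor
  · rintro ⟨G, hG, rfl⟩
    exact ⟨G, hG, hG.lang_sub_nl_eq_l σ⟩
  · rintro ⟨G, hG, rfl⟩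
    exact ⟨G, hG, (hG.lang_sub_nl_eq_l σ).symm⟩
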